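/- Let V be a finite type and r : V → V → Prop a directed-arc relation such that the directed graph (V, r) has no directed cycles (equivalently, the transitive closure of r is irreflexive). Let A ⊆ {(u,v) : r u v} be a set of selected arcs and let src, snk ∈ V with src ≠ snk such that: src has exactly one outgoing selected arc and no incoming selected arcs; snk has exactly one incoming selected arc and no outgoing selected arcs; and every other vertex v has equal numbers of incoming and outgoing selected arcs, each equal to either 0 or 1. Then the selected arcs form a single directed path from src to snk: there exists a sequence of vertices v_0 = src, v_1, ..., v_m = snk with pairwise distinct vertices such that A is exactly the set of arcs {(v_0,v_1), ..., (v_{m-1},v_m)}. -/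

import Mathlib

/-- If the reverse of `S` is well founded and every arc that does not end at `t` can be prolonged,
then every vertex that is `t` or has an outgoing arc is joined to `t` by a directed path. -/
theorem exists_path_to_of_wellFounded {V : Type*} {S : V → V → Prop} {t : V}
    (hwf : WellFounded (fun a b => S b a))
    (hext : ∀ u v, S u v → v ≠ t → ∃ w, S v w) (u : V) (hu : u = t ∨ ∃ w, S u w) :
    ∃ (m : ℕ) (v : Fin (m + 1) → V),
      v 0 = u ∧ v (Fin.last m) = t ∧ ∀ i : Fin m, S (v i.castSucc) (v i.succ) := by
  induction u using hwf.induction with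
  | _ u ih =>
    rcases hu with rfl | ⟨w, hw⟩
    · exact ⟨0, fun _ => u, rfl, rfl, fun i => i.elim0⟩
    · obtain ⟨m, v, h0, hlast, hv⟩ := ih w hw (or_iff_not_imp_left.2 (hext u w hw))
      refine ⟨m + 1, Fin.cons u v, rfl, ?_, fun i => ?_⟩
      · rw [← Fin.succ_last, Fin.cons_succ, hlast]
      · cases i using Fin.cases with
        | zero => simpa [h0] using hw
        | succ j => simpa [← Fin.succ_castSucc] using hv j

/-- A directed walk along an acyclic relation does not repeat vertices. -/
theorem injective_of_forall_rel_succ {V : Type*} {S : V → V → Prop}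
    (hacyc : ∀ v, ¬ Relation.TransGen S v v) {m : ℕ} {v : Fin (m + 1) → V}
    (hv : ∀ i : Fin m, S (v i.castSucc) (v i.succ)) : Function.Injective v := by
  have hlt : ∀ i j, i < j → Relation.TransGen S (v i) (v j) := fun i j hij =>
    (Fin.liftFun_iff_succ (Relation.TransGen S)).2 (fun i => .single (hv i)) hij
  intro i j hij
  rcases lt_trichotomy i j with h | h | h
  · exact absurd (hij ▸ hlt i j h) (hacyc _)
  · exact h
  · exact absurd (hij ▸ hlt j i h) (hacyc _)

/-- If out-neighbours are unique, `S` is well founded and every arc that does not start at `v 0` has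
a predecessor, then a directed path whose last vertex has no outgoing arc contains every arc. -/
theorem exists_eq_of_rel_of_path {V : Type*} {S : V → V → Prop} (hwf : WellFounded S)
    (huniq : ∀ a b c, S a b → S a c → b = c) {m : ℕ} {v : Fin (m + 1) → V}
    (hv : ∀ i : Fin m, S (v i.castSucc) (v i.succ)) (hlast : ∀ w, ¬ S (v (Fin.last m)) w)
    (hpred : ∀ a b, S a b → a ≠ v 0 → ∃ u, S u a) (a b : V) (hab : S a b) :
    ∃ i : Fin m, v i.castSucc = a ∧ v i.succ = b := by
  induction a using hwf.induction generalizing b with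
  | _ a ih =>
    have hmem : ∃ i, v i = a := by
      by_cases ha : a = v 0
      · exact ⟨0, ha.symm⟩
      · obtain ⟨u, hu⟩ := hpred a b hab ha
        obtain ⟨i, -, hi⟩ := ih u hu a hu
        exact ⟨i.succ, hi⟩
    obtain ⟨i, rfl⟩ := hmem
    cases i using Fin.lastCases with
    | last => exact absurd hab (hlast b)
    | cast i => exact ⟨i, rfl, huniq _ _ _ (hv i) hab⟩

/-- In a finite DAG, if a set `A` of selected arcs has exactly one arc leaving the source
`src` (and none entering it), exactly one arc entering the sink `snk` (and none leaving
it), and every other vertex has equal in- and out-degree in `A`, each equal to `0` or `1`,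
then `A` is exactly a single directed path from `src` to `snk` with pairwise distinct
vertices. -/
theorem selected_arcs_form_single_path
    {V : Type*} [Fintype V] [DecidableEq V]
    (r : V → V → Prop)
    (hacyc : ∀ v : V, ¬ Relation.TransGen r v v)
    (A : Finset (V × V))
    (hA : ∀ p ∈ A, r p.1 p.2)
    (src snk : V) (hne : src ≠ snk)
    (hsrc_out : (A.filter (fun p => p.1 = src)).card = 1)
    (hsrc_in : (A.filter (fun p => p.2 = src)).card = 0)
    (hsnk_in : (A.filter (fun p => p.2 = snk)).card = 1)
    (hsnk_out : (A.filter (fun p => p.1 = snk)).card = 0)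
    (hflow : ∀ v : V, v ≠ src → v ≠ snk →
      (A.filter (fun p => p.1 = v)).card = (A.filter (fun p => p.2 = v)).card ∧
      ((A.filter (fun p => p.1 = v)).card = 0 ∨ (A.filter (fun p => p.1 = v)).card = 1)) :
    ∃ (m : ℕ) (v : Fin (m + 1) → V),
      v 0 = src ∧ v (Fin.last m) = snk ∧ Function.Injective v ∧
      A = Finset.image (fun i : Fin m => (v i.castSucc, v i.succ)) Finset.univ := by
  have hacycA : ∀ v, ¬ Relation.TransGen (fun a b => (a, b) ∈ A) v v := fun v h =>
    hacyc v (Relation.TransGen.mono (fun a b hab => hA (a, b) hab) _ _ h)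
  have hwf : WellFounded (fun a b => (a, b) ∈ A) := by
    have : Std.Irrefl (Relation.TransGen (fun a b => (a, b) ∈ A)) := ⟨hacycA⟩
    exact Subrelation.wf (fun h => Relation.TransGen.single h)
      (Finite.wellFounded_of_trans_of_irrefl (Relation.TransGen (fun a b => (a, b) ∈ A)))
  have hwf' : WellFounded (fun a b => (b, a) ∈ A) := by
    have : Std.Irrefl (Function.swap (Relation.TransGen (fun a b => (a, b) ∈ A))) := ⟨hacycA⟩
    exact Subrelation.wf (fun h => Relation.TransGen.single h)
      (Finite.wellFounded_of_trans_of_irrefl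
        (Function.swap (Relation.TransGen (fun a b => (a, b) ∈ A))))
  have hout_pos : ∀ a, 0 < (A.filter (fun p => p.1 = a)).card ↔ ∃ b, (a, b) ∈ A := by
    simp [Finset.card_pos, Finset.Nonempty]
  have hin_pos : ∀ b, 0 < (A.filter (fun p => p.2 = b)).card ↔ ∃ a, (a, b) ∈ A := by
    simp [Finset.card_pos, Finset.Nonempty]
  have hsnk : ∀ w, (snk, w) ∉ A := fun w hw => by
    have := (hout_pos snk).2 ⟨w, hw⟩
    omega
  have hsrc : ∀ w, (w, src) ∉ A := fun w hw => by
    have := (hin_pos src).2 ⟨w, hw⟩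
    omega
  have huniq : ∀ a b c, (a, b) ∈ A → (a, c) ∈ A → b = c := by
    intro a b c hb hc
    have hle : (A.filter (fun p => p.1 = a)).card ≤ 1 := by
      by_cases h1 : a = src
      · exact h1 ▸ hsrc_out.le
      · have := (hflow a h1 (fun h => hsnk b (h ▸ hb))).2
        omega
    simpa using Finset.card_le_one.1 hle (a, b) (by simpa using hb) (a, c) (by simpa using hc)
  obtain ⟨m, v, h0, hlast, hv⟩ := exists_path_to_of_wellFounded (t := snk) hwf'
    (fun u v huv hne' => by
      rw [← hout_pos, (hflow v (fun h => hsrc u (h ▸ huv)) hne').1, hin_pos]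
      exact ⟨u, huv⟩)
    src (Or.inr ((hout_pos src).1 (by omega)))
  refine ⟨m, v, h0, hlast, injective_of_forall_rel_succ hacycA hv, ?_⟩
  ext ⟨a, b⟩
  simp only [Finset.mem_image, Finset.mem_univ, true_and, Prod.mk.injEq]
  constructor
  · refine exists_eq_of_rel_of_path hwf huniq hv (hlast ▸ hsnk) (fun a b hab ha => ?_) a b
    rw [← hin_pos, ← (hflow a (h0 ▸ ha) (fun h => hsnk b (h ▸ hab))).1, hout_pos]
    exact ⟨b, hab⟩
  · rintro ⟨i, rfl, rfl⟩
    exact hv i
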